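/- Let θ ∈ (0,1) and let K be a nonempty finite set. Let (λ_k)_{k∈K} be real-valued random variables and Λ_min < Λ_max reals with Λ_min ≤ λ_k ≤ Λ_max almost surely for every k ∈ K. Let (L_k)_{k∈K} and L_min > 0 be reals with L_k ≥ L_min for all k. Define Δ = ((Λ_max − Λ_min)/L_min) · √((1/2)·ln(3|K|/θ)) + max_{k∈K} E[λ_k]/L_k. Then ℙ(∃ k ∈ K : λ_k ≥ Δ·L_k) ≤ θ/3. -/

import Mathlib

open MeasureTheory ProbabilityTheory Finset

/-- **Hoeffding's inequality** for a single bounded random variable, with the deviation measured in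
units of the width of the interval. -/
lemma measureReal_integral_add_mul_le_of_mem_Icc {Ω : Type*} [MeasurableSpace Ω] {μ : Measure Ω}
    [IsProbabilityMeasure μ] {X : Ω → ℝ} {a b s : ℝ} (hm : AEMeasurable X μ) (hab : a < b)
    (hb : ∀ᵐ ω ∂μ, X ω ∈ Set.Icc a b) (hs : 0 ≤ s) :
    μ.real {ω | (∫ ω, X ω ∂μ) + (b - a) * s ≤ X ω} ≤ Real.exp (-(2 * s ^ 2)) := by
  have hba : 0 < b - a := sub_pos.2 hab
  have h := (hasSubgaussianMGF_of_mem_Icc hm hb).measure_ge_le (mul_nonneg hba.le hs)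
  have hexp : -((b - a) * s) ^ 2 / (2 * (((‖b - a‖₊ / 2) ^ 2 : NNReal) : ℝ)) = -(2 * s ^ 2) := by
    push_cast
    rw [Real.norm_of_nonneg hba.le]
    field
  rw [hexp] at h
  simpa only [le_sub_iff_add_le'] using h

/-- **latency part of Theorem 2 of the paper.** Let `λ_k` (`k ∈ K`) be
real random variables with `Λmin ≤ λ_k ≤ Λmax` almost surely (`Λmin < Λmax`), and latency
budgets `L k ≥ Lmin > 0`.  With
`Δ = ((Λmax - Λmin)/Lmin)·√((1/2)·ln(3|K|/θ)) + max_k E[λ_k]/L k`,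
one has `ℙ(∃ k, λ_k ≥ Δ·L k) ≤ θ/3`. -/
theorem latency_union_bound
    {Ωs : Type*} [MeasurableSpace Ωs] (μ : Measure Ωs) [IsProbabilityMeasure μ]
    (θ : ℝ) (hθ0 : 0 < θ) (hθ1 : θ < 1)
    {K : Type*} [Fintype K] [Nonempty K]
    (lam : K → Ωs → ℝ) (hmeas : ∀ k, Measurable (lam k))
    (Λmin Λmax : ℝ) (hΛ : Λmin < Λmax)
    (hbound : ∀ k, ∀ᵐ ω ∂μ, Λmin ≤ lam k ω ∧ lam k ω ≤ Λmax)
    (L : K → ℝ) (Lmin : ℝ) (hLmin : 0 < Lmin) (hL : ∀ k, Lmin ≤ L k)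
    (Δ : ℝ)
    (hΔ : Δ = (Λmax - Λmin) / Lmin *
        Real.sqrt (1 / 2 * Real.log (3 * (Fintype.card K) / θ)) +
      univ.sup' univ_nonempty (fun k => (∫ ω, lam k ω ∂μ) / L k)) :
    μ {ω | ∃ k, Δ * L k ≤ lam k ω} ≤ ENNReal.ofReal (θ / 3) := by
  have hcard : (1 : ℝ) ≤ Fintype.card K := by exact_mod_cast Fintype.card_pos (α := K)
  set s := Real.sqrt (1 / 2 * Real.log (3 * (Fintype.card K) / θ)) with hs
  have hs0 : 0 ≤ s := Real.sqrt_nonneg _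
  have hlog : 0 ≤ Real.log (3 * (Fintype.card K) / θ) :=
    Real.log_nonneg ((one_le_div hθ0).2 (by linarith))
  have hexp : Real.exp (-(2 * s ^ 2)) = θ / 3 / Fintype.card K := by
    rw [hs, Real.sq_sqrt (by positivity), ← mul_assoc, mul_one_div_cancel two_ne_zero, one_mul,
      Real.exp_neg, Real.exp_log (by positivity)]
    field
  have hthreshold (k : K) : (∫ ω, lam k ω ∂μ) + (Λmax - Λmin) * s ≤ Δ * L k := by
    have hLk : 0 < L k := hLmin.trans_le (hL k)
    have hmax : (∫ ω, lam k ω ∂μ) / L k ≤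
        univ.sup' univ_nonempty (fun k => (∫ ω, lam k ω ∂μ) / L k) :=
      le_sup' (fun k => (∫ ω, lam k ω ∂μ) / L k) (mem_univ k)
    have hwidth : (Λmax - Λmin) * s / L k ≤ (Λmax - Λmin) / Lmin * s := by
      rw [div_mul_eq_mul_div]
      exact div_le_div_of_nonneg_left (mul_nonneg (sub_nonneg.2 hΛ.le) hs0) hLmin (hL k)
    rw [← div_le_iff₀ hLk, add_div, hΔ]
    linarith
  have htail (k : K) : μ.real {ω | Δ * L k ≤ lam k ω} ≤ θ / 3 / Fintype.card K := by
    rw [← hexp]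
    refine le_trans (measureReal_mono fun ω hω => ?_)
      (measureReal_integral_add_mul_le_of_mem_Icc (hmeas k).aemeasurable hΛ (hbound k) hs0)
    exact (hthreshold k).trans hω
  rw [Set.ofPred_exists, ← ofReal_measureReal]
  refine ENNReal.ofReal_le_ofReal ((measureReal_iUnion_fintype_le _).trans ?_)
  calc ∑ k, μ.real {ω | Δ * L k ≤ lam k ω}
      ≤ ∑ _k : K, θ / 3 / Fintype.card K := sum_le_sum fun k _ => htail k
    _ = θ / 3 := by
      rw [sum_const, card_univ, nsmul_eq_mul]
      field
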